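/- Let A be a split regular BiHom-Poisson superalgebra with root system Λ. If Z(A) = 0 and H = Σ_{α∈Λ} ([A_{α∘ψ⁻¹}, A_{−α∘φ⁻¹}] + A_{α∘ψ⁻¹}·A_{−α∘φ⁻¹}), then A decomposes as the direct sum A = ⊕_{[α]∈Λ/∼} I_{[α]} of the ideals I_{[α]}, and moreover [I_{[α]}, I_{[β]}] + I_{[α]}·I_{[β]} = 0 whenever [α] ≠ [β]. -/

import Mathlib

/-- A (regular, with distinguished maximal abelian graded subalgebra `H`)
BiHom-Poisson superalgebra over a field `K`. -/
structure BHPS (K A : Type*) [Field K] [AddCommGroup A] [Module K A] where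
  /-- the ℤ₂-grading -/
  grade : ZMod 2 → Submodule K A
  gradeInternal : DirectSum.IsInternal grade
  /-- the bracket -/
  br : A →ₗ[K] A →ₗ[K] A
  /-- the associative-type product -/
  mu : A →ₗ[K] A →ₗ[K] A
  /-- the first structure map -/
  phi : A ≃ₗ[K] A
  /-- the second structure map -/
  psi : A ≃ₗ[K] A
  br_grade : ∀ (i j : ZMod 2), ∀ x ∈ grade i, ∀ y ∈ grade j, br x y ∈ grade (i + j)
  mu_grade : ∀ (i j : ZMod 2), ∀ x ∈ grade i, ∀ y ∈ grade j, mu x y ∈ grade (i + j)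
  phi_grade : ∀ i, (grade i).map (phi : A →ₗ[K] A) = grade i
  psi_grade : ∀ i, (grade i).map (psi : A →ₗ[K] A) = grade i
  phi_psi_comm : ∀ x, phi (psi x) = psi (phi x)
  phi_br : ∀ x y, phi (br x y) = br (phi x) (phi y)
  psi_br : ∀ x y, psi (br x y) = br (psi x) (psi y)
  phi_mu : ∀ x y, phi (mu x y) = mu (phi x) (phi y)
  psi_mu : ∀ x y, psi (mu x y) = mu (psi x) (psi y)
  skew : ∀ (i j : ZMod 2), ∀ x ∈ grade i, ∀ y ∈ grade j,
    br (psi x) (phi y) = -((-1 : K) ^ (i.val * j.val)) • br (psi y) (phi x)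
  jacobi : ∀ (i j k : ZMod 2), ∀ x ∈ grade i, ∀ y ∈ grade j, ∀ z ∈ grade k,
    ((-1 : K) ^ (i.val * k.val)) • br (psi (psi x)) (br (psi y) (phi z))
      + ((-1 : K) ^ (i.val * j.val)) • br (psi (psi y)) (br (psi z) (phi x))
      + ((-1 : K) ^ (j.val * k.val)) • br (psi (psi z)) (br (psi x) (phi y)) = 0
  assoc : ∀ x y z, mu (phi x) (mu y z) = mu (mu x y) (psi z)
  leibniz : ∀ (j k : ZMod 2), ∀ (x : A), ∀ y ∈ grade j, ∀ z ∈ grade k,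
    br (mu x y) (phi (psi z))
      = mu (phi x) (br y (phi z)) + ((-1 : K) ^ (j.val * k.val)) • mu (br x (psi z)) (phi y)
  /-- the maximal abelian graded subalgebra -/
  H : Submodule K A
  H_graded : H = (H ⊓ grade 0) ⊔ (H ⊓ grade 1)
  H_abelian : ∀ x ∈ H, ∀ y ∈ H, br x y = 0
  phi_H : H.map (phi : A →ₗ[K] A) = H
  psi_H : H.map (psi : A →ₗ[K] A) = H
  H_max : ∀ H' : Submodule K A, H ≤ H' →
    H' = (H' ⊓ grade 0) ⊔ (H' ⊓ grade 1) →
    (∀ x ∈ H', ∀ y ∈ H', br x y = 0) →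
    H'.map (phi : A →ₗ[K] A) = H' → H'.map (psi : A →ₗ[K] A) = H' → H' = H

namespace BHPS

variable {K A : Type*} [Field K] [AddCommGroup A] [Module K A] (D : BHPS K A)

/-- The even part `H₀` of `H`. -/
def H0 : Submodule K A := D.H ⊓ D.grade 0

lemma phi_H0 : D.H0.map (D.phi : A →ₗ[K] A) = D.H0 := by
  unfold H0
  rw [Submodule.map_inf (D.phi : A →ₗ[K] A) D.phi.injective, D.phi_H, D.phi_grade]

lemma psi_H0 : D.H0.map (D.psi : A →ₗ[K] A) = D.H0 := by
  unfold H0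
  rw [Submodule.map_inf (D.psi : A →ₗ[K] A) D.psi.injective, D.psi_H, D.psi_grade]

/-- The restriction of `φ` to `H₀`, as a linear automorphism. -/
def phiH0 : ↥D.H0 ≃ₗ[K] ↥D.H0 :=
  (D.phi.submoduleMap D.H0).trans (LinearEquiv.ofEq _ _ D.phi_H0)

/-- The restriction of `ψ` to `H₀`, as a linear automorphism. -/
def psiH0 : ↥D.H0 ≃ₗ[K] ↥D.H0 :=
  (D.psi.submoduleMap D.H0).trans (LinearEquiv.ofEq _ _ D.psi_H0)

/-- The root space attached to a linear functional `α : H₀ → K`: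
`A_α = {v : [h, φ(v)] = α(h) • φψ(v) for all h ∈ H₀}`. -/
def rootSpace (α : Module.Dual K ↥D.H0) : Submodule K A where
  carrier := {v | ∀ h : ↥D.H0, D.br (h : A) (D.phi v) = α h • D.phi (D.psi v)}
  add_mem' := by
    intro a b ha hb h
    simp only [map_add, ha h, hb h, smul_add]
  zero_mem' := by
    intro h
    simp
  smul_mem' := by
    intro c v hv h
    simp only [map_smul, hv h]
    rw [smul_comm]

/-- The root system `Λ`. -/
def roots : Set (Module.Dual K ↥D.H0) := {α | α ≠ 0 ∧ D.rootSpace α ≠ ⊥}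

/-- `A` is split with respect to `H`: `A = H ⊕ (⊕_{α ∈ Λ} A_α)`. -/
def IsSplit : Prop :=
  letI := Classical.decEq (Option ↥D.roots)
  DirectSum.IsInternal (fun o : Option ↥D.roots => o.elim D.H fun α => D.rootSpace α.1)

/-- `α ∘ φ^{z₁} ∘ ψ^{z₂}`. -/
def twist (z₁ z₂ : ℤ) (γ : Module.Dual K ↥D.H0) : Module.Dual K ↥D.H0 :=
  γ ∘ₗ ((((D.phiH0 ^ z₁) : ↥D.H0 ≃ₗ[K] ↥D.H0) : ↥D.H0 →ₗ[K] ↥D.H0) ∘ₗ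
        (((D.psiH0 ^ z₂) : ↥D.H0 ≃ₗ[K] ↥D.H0) : ↥D.H0 →ₗ[K] ↥D.H0))

/-- `±S = S ∪ (-S)`. -/
def pm (S : Set (Module.Dual K ↥D.H0)) : Set (Module.Dual K ↥D.H0) :=
  S ∪ (Neg.neg '' S)

/-- The partial sums `α₁∘φ^{-i} + α₂∘φ^{-i+1}∘ψ^{-1} + ⋯ + α_i∘φ^{-1}∘ψ^{-1} + α_{i+1}∘ψ^{-1}`
appearing in the definition of a connection. -/
def chainSum (a : ℕ → Module.Dual K ↥D.H0) (i : ℕ) : Module.Dual K ↥D.H0 :=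
  D.twist (-(i : ℤ)) 0 (a 1)
    + ∑ t ∈ Finset.Icc 2 (i + 1), D.twist (-((i : ℤ) + 1 - (t : ℤ))) (-1) (a t)

/-- `a 1, …, a k` is a connection from `α` to `β` (relative to the set of roots `S`). -/
def IsConnectionIn (S : Set (Module.Dual K ↥D.H0)) (α β : Module.Dual K ↥D.H0)
    (k : ℕ) (a : ℕ → Module.Dual K ↥D.H0) : Prop :=
  2 ≤ k ∧
  (∀ t, 1 ≤ t → t ≤ k → a t ∈ D.pm S) ∧
  (∃ n r : ℕ, a 1 = D.twist (-(n : ℤ)) (-(r : ℤ)) α) ∧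
  (∀ i, 1 ≤ i → i ≤ k - 2 → D.chainSum a i ∈ D.pm S) ∧
  (∃ m s : ℕ, D.chainSum a (k - 1) = D.twist (-(m : ℤ)) (-(s : ℤ)) β
      ∨ D.chainSum a (k - 1) = -(D.twist (-(m : ℤ)) (-(s : ℤ)) β))

/-- `α` is connected to `β` (relative to the set of roots `S`). -/
def ConnectedIn (S : Set (Module.Dual K ↥D.H0)) (α β : Module.Dual K ↥D.H0) : Prop :=
  (∃ z₁ z₂ : ℤ, ∃ ε : K, (ε = 1 ∨ ε = -1) ∧ β = ε • D.twist z₁ z₂ α) ∨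
  (∃ k a, D.IsConnectionIn S α β k a)

/-- `α` is connected to `β`. -/
def Connected (α β : Module.Dual K ↥D.H0) : Prop := D.ConnectedIn D.roots α β

/-- The set `[α]` of roots connected to `α`. -/
def classSet (α : Module.Dual K ↥D.H0) : Set (Module.Dual K ↥D.H0) :=
  {β ∈ D.roots | D.Connected α β}

/-- `I_{H,[α]} = span {[A_{β∘ψ⁻¹}, A_{−β∘φ⁻¹}] + A_{β∘ψ⁻¹}·A_{−β∘φ⁻¹} : β ∈ [α]}`. -/
def IH (α : Module.Dual K ↥D.H0) : Submodule K A :=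
  ⨆ β ∈ D.classSet α,
    (Submodule.map₂ D.br (D.rootSpace (D.twist 0 (-1) β)) (D.rootSpace (-(D.twist (-1) 0 β)))
      ⊔ Submodule.map₂ D.mu (D.rootSpace (D.twist 0 (-1) β)) (D.rootSpace (-(D.twist (-1) 0 β))))

/-- `V_{[α]} = ⊕_{β ∈ [α]} A_β`. -/
def VS (α : Module.Dual K ↥D.H0) : Submodule K A :=
  ⨆ β ∈ D.classSet α, D.rootSpace β

/-- `I_{[α]} = I_{H,[α]} ⊕ V_{[α]}`. -/
def Iclass (α : Module.Dual K ↥D.H0) : Submodule K A := D.IH α ⊔ D.VS α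

/-- `J` is an ideal of the (sub)algebra `I`. -/
def IsIdealIn (J I : Submodule K A) : Prop :=
  J ≤ I ∧ J = (J ⊓ D.grade 0) ⊔ (J ⊓ D.grade 1) ∧
  Submodule.map₂ D.br J I ≤ J ∧ Submodule.map₂ D.mu J I ≤ J ∧ Submodule.map₂ D.mu I J ≤ J ∧
  J.map (D.phi : A →ₗ[K] A) = J ∧ J.map (D.psi : A →ₗ[K] A) = J

/-- `I` is an ideal of `A`: `[I,A] + I·A + A·I ⊆ I`, graded and `φ,ψ`-invariant. -/
def IsIdeal (I : Submodule K A) : Prop := D.IsIdealIn I ⊤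

/-- `A` is simple: `[A,A] + A·A ≠ 0` and its only ideals are `0` and `A`. -/
def IsSimple : Prop :=
  (Submodule.map₂ D.br ⊤ ⊤ ⊔ Submodule.map₂ D.mu (⊤ : Submodule K A) ⊤ ≠ ⊥) ∧
  ∀ I : Submodule K A, D.IsIdeal I → I = ⊥ ∨ I = ⊤

/-- The center `Z(A) = {v : [v,A] + v·A + A·v = 0}`. -/
def center : Submodule K A where
  carrier := {v | ∀ w, D.br v w = 0 ∧ D.mu v w = 0 ∧ D.mu w v = 0}
  add_mem' := by
    intro a b ha hb w
    obtain ⟨h1, h2, h3⟩ := ha w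
    obtain ⟨g1, g2, g3⟩ := hb w
    simp [map_add, LinearMap.add_apply, h1, h2, h3, g1, g2, g3]
  zero_mem' := by intro w; simp
  smul_mem' := by
    intro c v hv w
    obtain ⟨h1, h2, h3⟩ := hv w
    simp [map_smul, LinearMap.smul_apply, h1, h2, h3]

/-- `Σ_{α∈Λ} ([A_{α∘ψ⁻¹}, A_{−α∘φ⁻¹}] + A_{α∘ψ⁻¹}·A_{−α∘φ⁻¹})`. -/
def HSum : Submodule K A :=
  ⨆ α ∈ D.roots,
    (Submodule.map₂ D.br (D.rootSpace (D.twist 0 (-1) α)) (D.rootSpace (-(D.twist (-1) 0 α)))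
      ⊔ Submodule.map₂ D.mu (D.rootSpace (D.twist 0 (-1) α)) (D.rootSpace (-(D.twist (-1) 0 α))))

/-- The root system is symmetric. -/
def IsSymmetric : Prop := ∀ α ∈ D.roots, -α ∈ D.roots

/-- `A` is root multiplicative. -/
def RootMultiplicative : Prop :=
  ∀ (i j : ZMod 2) (α β : Module.Dual K ↥D.H0), α ∈ D.roots → β ∈ D.roots →
    D.rootSpace α ⊓ D.grade i ≠ ⊥ → D.rootSpace β ⊓ D.grade j ≠ ⊥ →
    (D.twist 0 (-1) α + D.twist (-1) 0 β) ∈ D.roots →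
    D.rootSpace (D.twist 0 (-1) α + D.twist (-1) 0 β) ⊓ D.grade (i + j) ≠ ⊥ →
    Submodule.map₂ D.br (D.rootSpace α ⊓ D.grade i) (D.rootSpace β ⊓ D.grade j)
      ⊔ Submodule.map₂ D.mu (D.rootSpace α ⊓ D.grade i) (D.rootSpace β ⊓ D.grade j) ≠ ⊥

/-- `A` is of maximal length: every nonzero graded root space is one-dimensional. -/
def MaximalLength : Prop :=
  ∀ (i : ZMod 2), ∀ α ∈ D.roots, D.rootSpace α ⊓ D.grade i ≠ ⊥ →
    Module.rank K ↥(D.rootSpace α ⊓ D.grade i) = 1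

end BHPS

namespace BHPS

variable {K A : Type*}

section Twist

variable [Field K] [AddCommGroup A] [Module K A] (D : BHPS K A)

lemma coe_phiH0 (h : ↥D.H0) : (D.phiH0 h : A) = D.phi h := rfl

lemma coe_psiH0 (h : ↥D.H0) : (D.psiH0 h : A) = D.psi h := rfl

lemma commute_phiH0_psiH0 : Commute D.phiH0 D.psiH0 :=
  LinearEquiv.ext fun h => Subtype.ext (D.phi_psi_comm h)

lemma twist_apply (a b : ℤ) (γ : Module.Dual K ↥D.H0) (h : ↥D.H0) :
    D.twist a b γ h = γ ((D.phiH0 ^ a) ((D.psiH0 ^ b) h)) := rfl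

@[simp] lemma twist_add (a b : ℤ) (γ δ : Module.Dual K ↥D.H0) :
    D.twist a b (γ + δ) = D.twist a b γ + D.twist a b δ := rfl

@[simp] lemma twist_neg (a b : ℤ) (γ : Module.Dual K ↥D.H0) :
    D.twist a b (-γ) = -D.twist a b γ := rfl

@[simp] lemma twist_sub (a b : ℤ) (γ δ : Module.Dual K ↥D.H0) :
    D.twist a b (γ - δ) = D.twist a b γ - D.twist a b δ := rfl

@[simp] lemma twist_zero (a b : ℤ) : D.twist a b 0 = 0 := rfl

@[simp] lemma twist_units_smul (a b : ℤ) (ε : ℤˣ) (γ : Module.Dual K ↥D.H0) :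
    D.twist a b (ε • γ) = ε • D.twist a b γ := by
  rcases Int.units_eq_one_or ε with rfl | rfl <;> simp

lemma twist_sum (a b : ℤ) (s : Finset ℕ) (f : ℕ → Module.Dual K ↥D.H0) :
    D.twist a b (∑ t ∈ s, f t) = ∑ t ∈ s, D.twist a b (f t) :=
  LinearMap.ext fun h => by simp [twist_apply, LinearMap.sum_apply]

@[simp] lemma twist_zero_zero (γ : Module.Dual K ↥D.H0) : D.twist 0 0 γ = γ := rfl

@[simp] lemma twist_twist (a b c d : ℤ) (γ : Module.Dual K ↥D.H0) :
    D.twist a b (D.twist c d γ) = D.twist (a + c) (b + d) γ := by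
  ext h
  simp only [twist_apply]
  congr 1
  have key : D.phiH0 ^ c * D.psiH0 ^ d * (D.phiH0 ^ a * D.psiH0 ^ b)
      = D.phiH0 ^ (a + c) * D.psiH0 ^ (b + d) := by
    rw [add_comm a c, add_comm b d, zpow_add, zpow_add, mul_assoc, mul_assoc,
      ← mul_assoc (D.psiH0 ^ d), ← ((D.commute_phiH0_psiH0.zpow_zpow a d).eq), mul_assoc]
  exact congrArg (fun f : ↥D.H0 ≃ₗ[K] ↥D.H0 => f h) key

lemma twist_neg_one_zero_phiH0 (γ : Module.Dual K ↥D.H0) (h : ↥D.H0) :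
    D.twist (-1) 0 γ (D.phiH0 h) = γ h := by
  have : (D.phiH0 ^ (-1 : ℤ)) (D.phiH0 h) = h := by
    rw [zpow_neg_one]; exact D.phiH0.symm_apply_apply h
  rw [twist_apply]
  exact congrArg γ this

lemma twist_zero_neg_one_psiH0 (γ : Module.Dual K ↥D.H0) (h : ↥D.H0) :
    D.twist 0 (-1) γ (D.psiH0 h) = γ h := by
  have : (D.psiH0 ^ (-1 : ℤ)) (D.psiH0 h) = h := by
    rw [zpow_neg_one]; exact D.psiH0.symm_apply_apply h
  rw [twist_apply]
  exact congrArg γ this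

lemma twist_eq_zero_iff {a b : ℤ} {γ : Module.Dual K ↥D.H0} : D.twist a b γ = 0 ↔ γ = 0 := by
  refine ⟨fun h => ?_, fun h => by simp [h]⟩
  have := congrArg (D.twist (-a) (-b)) h
  simpa using this

end Twist

section RootSpace

variable [Field K] [AddCommGroup A] [Module K A] {D : BHPS K A}

lemma mem_rootSpace {γ : Module.Dual K ↥D.H0} {v : A} :
    v ∈ D.rootSpace γ ↔ ∀ h : ↥D.H0, D.br (h : A) (D.phi v) = γ h • D.phi (D.psi v) := Iff.rfl

lemma phi_mem_rootSpace_iff {γ : Module.Dual K ↥D.H0} {v : A} :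
    D.phi v ∈ D.rootSpace (D.twist (-1) 0 γ) ↔ v ∈ D.rootSpace γ := by
  rw [mem_rootSpace, mem_rootSpace, D.phiH0.surjective.forall]
  refine forall_congr' fun h => ?_
  rw [twist_neg_one_zero_phiH0, coe_phiH0, ← D.phi_br, ← D.phi_psi_comm, ← map_smul,
    D.phi.injective.eq_iff]

lemma psi_mem_rootSpace_iff {γ : Module.Dual K ↥D.H0} {v : A} :
    D.psi v ∈ D.rootSpace (D.twist 0 (-1) γ) ↔ v ∈ D.rootSpace γ := by
  rw [mem_rootSpace, mem_rootSpace, D.psiH0.surjective.forall]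
  refine forall_congr' fun h => ?_
  rw [twist_zero_neg_one_psiH0, coe_psiH0, D.phi_psi_comm, ← D.psi_br, D.phi_psi_comm,
    ← D.phi_psi_comm v, ← map_smul, D.psi.injective.eq_iff]

lemma map_phi_rootSpace (γ : Module.Dual K ↥D.H0) :
    (D.rootSpace γ).map (D.phi : A →ₗ[K] A) = D.rootSpace (D.twist (-1) 0 γ) := by
  ext v
  obtain ⟨w, rfl⟩ := D.phi.surjective v
  rw [phi_mem_rootSpace_iff]
  exact D.phi.injective.mem_set_image

lemma map_psi_rootSpace (γ : Module.Dual K ↥D.H0) :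
    (D.rootSpace γ).map (D.psi : A →ₗ[K] A) = D.rootSpace (D.twist 0 (-1) γ) := by
  ext v
  obtain ⟨w, rfl⟩ := D.psi.surjective v
  rw [psi_mem_rootSpace_iff]
  exact D.psi.injective.mem_set_image

lemma rootSpace_twist_phi_ne_bot_iff {γ : Module.Dual K ↥D.H0} :
    D.rootSpace (D.twist (-1) 0 γ) ≠ ⊥ ↔ D.rootSpace γ ≠ ⊥ := by
  rw [← map_phi_rootSpace]
  exact (Submodule.map_injective_of_injective D.phi.injective).ne_iff' (Submodule.map_bot _)

lemma rootSpace_twist_psi_ne_bot_iff {γ : Module.Dual K ↥D.H0} :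
    D.rootSpace (D.twist 0 (-1) γ) ≠ ⊥ ↔ D.rootSpace γ ≠ ⊥ := by
  rw [← map_psi_rootSpace]
  exact (Submodule.map_injective_of_injective D.psi.injective).ne_iff' (Submodule.map_bot _)

lemma twist_mem_roots {γ : Module.Dual K ↥D.H0} (hγ : γ ∈ D.roots) (a b : ℤ) :
    D.twist a b γ ∈ D.roots := by
  have hphi : D.rootSpace (D.twist a 0 γ) ≠ ⊥ := by
    induction a with
    | zero => exact hγ.2
    | succ n ih =>
      rw [← rootSpace_twist_phi_ne_bot_iff, twist_twist]
      simpa using ih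
    | pred n ih =>
      rw [← rootSpace_twist_phi_ne_bot_iff, twist_twist] at ih
      simpa [sub_eq_neg_add] using ih
  have hpsi : D.rootSpace (D.twist a b γ) ≠ ⊥ := by
    induction b with
    | zero => exact hphi
    | succ n ih =>
      rw [← rootSpace_twist_psi_ne_bot_iff, twist_twist]
      simpa using ih
    | pred n ih =>
      rw [← rootSpace_twist_psi_ne_bot_iff, twist_twist] at ih
      simpa [sub_eq_neg_add] using ih
  exact ⟨fun h => hγ.1 (D.twist_eq_zero_iff.1 h), hpsi⟩

lemma exists_grade_add (v : A) : ∃ x ∈ D.grade 0, ∃ y ∈ D.grade 1, x + y = v := by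
  have h : v ∈ ⨆ i, D.grade i := by
    rw [D.gradeInternal.submodule_iSup_eq_top]; trivial
  have h2 : (⨆ i, D.grade i) = D.grade 0 ⊔ D.grade 1 := by
    refine le_antisymm (iSup_le fun i => ?_) (sup_le (le_iSup _ _) (le_iSup _ _))
    fin_cases i
    · exact le_sup_left
    · exact le_sup_right
  rw [h2] at h
  exact Submodule.mem_sup.1 h

lemma phi_mem_grade {i : ZMod 2} {x : A} (hx : x ∈ D.grade i) : D.phi x ∈ D.grade i := by
  rw [← D.phi_grade i]; exact Submodule.mem_map_of_mem hx

lemma psi_mem_grade {i : ZMod 2} {x : A} (hx : x ∈ D.grade i) : D.psi x ∈ D.grade i := by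
  rw [← D.psi_grade i]; exact Submodule.mem_map_of_mem hx

lemma mem_grade_of_phi_mem {i : ZMod 2} {x : A} (hx : D.phi x ∈ D.grade i) : x ∈ D.grade i := by
  rw [← D.phi_grade i] at hx
  obtain ⟨y, hy, hyx⟩ := hx
  rwa [← D.phi.injective hyx]

lemma mem_grade_of_psi_mem {i : ZMod 2} {x : A} (hx : D.psi x ∈ D.grade i) : x ∈ D.grade i := by
  rw [← D.psi_grade i] at hx
  obtain ⟨y, hy, hyx⟩ := hx
  rwa [← D.psi.injective hyx]

lemma eq_zero_of_grade_add {x y : A} (hx : x ∈ D.grade 0) (hy : y ∈ D.grade 1)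
    (h : x + y = 0) : x = 0 ∧ y = 0 := by
  have hdisj : Disjoint (D.grade 0) (D.grade 1) :=
    D.gradeInternal.submodule_iSupIndep.pairwiseDisjoint (by decide)
  have hx' : x = 0 := by
    refine Submodule.disjoint_def.1 hdisj x hx ?_
    rw [eq_neg_of_add_eq_zero_left h]
    exact neg_mem hy
  exact ⟨hx', by simpa [hx'] using h⟩

/-- Homogeneous components of an element of a root space stay in the root space. -/
lemma rootSpace_graded (γ : Module.Dual K ↥D.H0) :
    D.rootSpace γ ≤ (D.rootSpace γ ⊓ D.grade 0) ⊔ (D.rootSpace γ ⊓ D.grade 1) := by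
  intro v hv
  obtain ⟨x, hx, y, hy, rfl⟩ := D.exists_grade_add v
  have key : ∀ h : ↥D.H0,
      D.br (h : A) (D.phi x) - γ h • D.phi (D.psi x) = 0 ∧
        D.br (h : A) (D.phi y) - γ h • D.phi (D.psi y) = 0 := by
    intro h
    refine D.eq_zero_of_grade_add ?_ ?_ ?_
    · refine sub_mem ?_ (Submodule.smul_mem _ _ (phi_mem_grade (psi_mem_grade hx)))
      simpa using D.br_grade 0 0 _ h.2.2 _ (phi_mem_grade hx)
    · refine sub_mem ?_ (Submodule.smul_mem _ _ (phi_mem_grade (psi_mem_grade hy)))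
      simpa using D.br_grade 0 1 _ h.2.2 _ (phi_mem_grade hy)
    · have := hv h
      simp only [map_add, smul_add] at this
      rw [sub_add_sub_comm, this, sub_self]
  exact Submodule.add_mem_sup ⟨fun h => sub_eq_zero.1 (key h).1, hx⟩
    ⟨fun h => sub_eq_zero.1 (key h).2, hy⟩

lemma homogeneous_induction {U : Submodule K A}
    (hU : U ≤ (U ⊓ D.grade 0) ⊔ (U ⊓ D.grade 1)) {p : A → Prop}
    (hom : ∀ i, ∀ u ∈ U, u ∈ D.grade i → p u) (add : ∀ u v, p u → p v → p (u + v)) :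
    ∀ u ∈ U, p u := by
  intro u hu
  obtain ⟨x, hx, y, hy, rfl⟩ := Submodule.mem_sup.1 (hU hu)
  exact add _ _ (hom 0 x hx.1 hx.2) (hom 1 y hy.1 hy.2)

lemma br_psi_phi_H0 (h : ↥D.H0) (v : A) :
    D.br (D.psi v) (D.phi h) = -D.br (D.psi (h : A)) (D.phi v) := by
  obtain ⟨x, hx, y, hy, rfl⟩ := D.exists_grade_add v
  have h0 := D.skew 0 0 x hx h h.2.2
  have h1 := D.skew 1 0 y hy h h.2.2
  simp only [ZMod.val_zero, mul_zero, pow_zero, neg_smul, one_smul] at h0 h1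
  simp only [map_add, LinearMap.add_apply, h0, h1]
  abel

lemma br_psi_phi_of_mem_rootSpace {γ : Module.Dual K ↥D.H0} {v : A} (hv : v ∈ D.rootSpace γ)
    (h : ↥D.H0) : D.br (D.psi v) (D.phi h) = -(γ (D.psiH0 h) • D.phi (D.psi v)) := by
  rw [br_psi_phi_H0, ← coe_psiH0, hv]

lemma leibniz_H0 (x y : A) (h : ↥D.H0) :
    D.br (D.mu x y) (D.phi (D.psi h))
      = D.mu (D.phi x) (D.br y (D.phi h)) + D.mu (D.br x (D.psi h)) (D.phi y) := by
  obtain ⟨y₀, hy₀, y₁, hy₁, rfl⟩ := D.exists_grade_add y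
  have h0 := D.leibniz 0 0 x y₀ hy₀ h h.2.2
  have h1 := D.leibniz 1 0 x y₁ hy₁ h h.2.2
  simp only [ZMod.val_zero, mul_zero, pow_zero, one_smul] at h0 h1
  simp only [map_add, LinearMap.add_apply, h0, h1]
  abel

lemma mu_mem_rootSpace {α β : Module.Dual K ↥D.H0} {x y : A} (hx : x ∈ D.rootSpace α)
    (hy : y ∈ D.rootSpace β) :
    D.mu x y ∈ D.rootSpace (D.twist (-1) 0 α + D.twist 0 (-1) β) := by
  intro k
  obtain ⟨k, rfl⟩ := D.psiH0.surjective k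
  obtain ⟨k, rfl⟩ := D.psiH0.surjective k
  obtain ⟨h, rfl⟩ := D.phiH0.surjective k
  have hcomm : ∀ h, D.phiH0 (D.psiH0 h) = D.psiH0 (D.phiH0 h) := fun h =>
    Subtype.ext (D.phi_psi_comm h)
  have key := leibniz_H0 (D.psi x) (D.psi y) (D.phiH0 h)
  rw [br_psi_phi_of_mem_rootSpace hy, ← D.psi_mu, ← coe_psiH0, br_psi_phi_H0] at key
  rw [← hcomm, coe_phiH0, br_psi_phi_of_mem_rootSpace hx, ← coe_phiH0, hcomm, ← coe_psiH0] at key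
  rw [LinearMap.add_apply, twist_zero_neg_one_psiH0, ← hcomm, ← hcomm, twist_neg_one_zero_phiH0,
    hcomm, hcomm, ← neg_inj, key, D.psi_mu, D.phi_mu]
  simp only [map_neg, map_smul, LinearMap.neg_apply, LinearMap.smul_apply, add_smul]
  abel

lemma br_mem_rootSpace {α β : Module.Dual K ↥D.H0} {x y : A} (hx : x ∈ D.rootSpace α)
    (hy : y ∈ D.rootSpace β) :
    D.br x y ∈ D.rootSpace (D.twist (-1) 0 α + D.twist 0 (-1) β) := by
  refine homogeneous_induction (rootSpace_graded α)
    (p := fun x => D.br x y ∈ D.rootSpace (D.twist (-1) 0 α + D.twist 0 (-1) β))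
    (fun i x hx hxi => ?_)
    (fun u v hu hv => by rw [map_add, LinearMap.add_apply]; exact add_mem hu hv) x hx
  refine homogeneous_induction (rootSpace_graded β)
    (p := fun y => D.br x y ∈ D.rootSpace (D.twist (-1) 0 α + D.twist 0 (-1) β))
    (fun j y hy hyj => ?_)
    (fun u v hu hv => by rw [map_add]; exact add_mem hu hv) y hy
  intro k
  obtain ⟨h, rfl⟩ := D.psiH0.surjective k
  have hx' := phi_mem_rootSpace_iff.2 hx
  have hy' := psi_mem_rootSpace_iff.2 hy
  have key := D.jacobi 0 i j h h.2.2 _ (phi_mem_grade hxi) _ (psi_mem_grade hyj)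
  have hskew := D.skew j i _ (psi_mem_grade (psi_mem_grade hyj)) _
    (psi_mem_grade (phi_mem_grade hxi))
  rw [br_psi_phi_of_mem_rootSpace hy', ← coe_psiH0, hx'] at key
  have hsq : (-1 : K) ^ (i.val * j.val) * (-1 : K) ^ (j.val * i.val) = 1 := by
    rw [mul_comm j.val, ← mul_pow]; simp
  simp only [ZMod.val_zero, zero_mul, pow_zero, one_smul, map_neg, map_smul, hskew,
    smul_smul, smul_neg, neg_smul] at key
  rw [mul_left_comm, hsq, mul_one, one_mul] at key
  apply D.psi.injective
  rw [D.psi_br, map_smul, LinearMap.add_apply, add_smul]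
  simp only [D.phi_br, D.psi_br, coe_psiH0, D.phi_psi_comm] at key ⊢
  rw [← sub_eq_zero, ← key]
  abel

end RootSpace

section Orthogonality

variable [Field K] [AddCommGroup A] [Module K A] {D : BHPS K A}

variable (D) in
/-- A graded subspace on which `φ` and `ψ` restrict to automorphisms. -/
structure IsStable (U : Submodule K A) : Prop where
  graded : U ≤ (U ⊓ D.grade 0) ⊔ (U ⊓ D.grade 1)
  map_phi : U.map (D.phi : A →ₗ[K] A) = U
  map_psi : U.map (D.psi : A →ₗ[K] A) = U

lemma IsStable.phi_mem_iff {U : Submodule K A} (hU : D.IsStable U) {x : A} :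
    D.phi x ∈ U ↔ x ∈ U := by
  conv_lhs => rw [← hU.map_phi]
  exact D.phi.injective.mem_set_image

lemma IsStable.psi_mem_iff {U : Submodule K A} (hU : D.IsStable U) {x : A} :
    D.psi x ∈ U ↔ x ∈ U := by
  conv_lhs => rw [← hU.map_psi]
  exact D.psi.injective.mem_set_image

lemma IsStable.sup {U W : Submodule K A} (hU : D.IsStable U) (hW : D.IsStable W) :
    D.IsStable (U ⊔ W) where
  graded := sup_le
    (hU.graded.trans (sup_le_sup (inf_le_inf_right _ le_sup_left) (inf_le_inf_right _ le_sup_left)))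
    (hW.graded.trans (sup_le_sup (inf_le_inf_right _ le_sup_right)
      (inf_le_inf_right _ le_sup_right)))
  map_phi := by rw [Submodule.map_sup, hU.map_phi, hW.map_phi]
  map_psi := by rw [Submodule.map_sup, hU.map_psi, hW.map_psi]

lemma map_map₂_self {U : Submodule K A} {f : A →ₗ[K] A →ₗ[K] A} {g : A →ₗ[K] A}
    (hg : ∀ x y, g (f x y) = f (g x) (g y)) (hU : U.map g = U) :
    (Submodule.map₂ f U U).map g = Submodule.map₂ f U U := by
  refine le_antisymm (Submodule.map_le_iff_le_comap.2 (Submodule.map₂_le.2 fun x hx y hy => ?_))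
    (Submodule.map₂_le.2 fun x hx y hy => ?_)
  · rw [Submodule.mem_comap, hg]
    refine Submodule.apply_mem_map₂ _ ?_ ?_ <;> rw [← hU] <;>
      exact Submodule.mem_map_of_mem (by assumption)
  · rw [← hU] at hx hy
    obtain ⟨x, hx, rfl⟩ := hx
    obtain ⟨y, hy, rfl⟩ := hy
    rw [← hg]
    exact Submodule.mem_map_of_mem (Submodule.apply_mem_map₂ _ hx hy)

lemma IsStable.map₂ {U : Submodule K A} (hU : D.IsStable U) {f : A →ₗ[K] A →ₗ[K] A}
    (hgrade : ∀ i j : ZMod 2, ∀ x ∈ D.grade i, ∀ y ∈ D.grade j, f x y ∈ D.grade (i + j))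
    (hphi : ∀ x y, D.phi (f x y) = f (D.phi x) (D.phi y))
    (hpsi : ∀ x y, D.psi (f x y) = f (D.psi x) (D.psi y)) :
    D.IsStable (Submodule.map₂ f U U) where
  graded := by
    refine Submodule.map₂_le.2 fun x hx y hy => ?_
    refine homogeneous_induction hU.graded (p := fun x => f x y ∈ _) (fun i x hx hxi => ?_)
      (fun u v hu hv => by rw [map_add, LinearMap.add_apply]; exact add_mem hu hv) x hx
    refine homogeneous_induction hU.graded (p := fun y => f x y ∈ _) (fun j y hy hyj => ?_)
      (fun u v hu hv => by rw [map_add]; exact add_mem hu hv) y hy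
    have hmem := Submodule.apply_mem_map₂ f hx hy
    have hg := hgrade i j x hxi y hyj
    generalize i + j = l at hg
    fin_cases l
    · exact Submodule.mem_sup_left ⟨hmem, hg⟩
    · exact Submodule.mem_sup_right ⟨hmem, hg⟩
  map_phi := map_map₂_self hphi hU.map_phi
  map_psi := map_map₂_self hpsi hU.map_psi

variable (D) in
/-- The span of all brackets and products of two elements of `U`. -/
def productSpan (U : Submodule K A) : Submodule K A :=
  Submodule.map₂ D.br U U ⊔ Submodule.map₂ D.mu U U

lemma IsStable.productSpan {U : Submodule K A} (hU : D.IsStable U) :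
    D.IsStable (D.productSpan U) :=
  (hU.map₂ D.br_grade D.phi_br D.psi_br).sup (hU.map₂ D.mu_grade D.phi_mu D.psi_mu)

variable (D) in
/-- All brackets and products of `u` and `w`, in either order, vanish. -/
structure Orthogonal (u w : A) : Prop where
  br : D.br u w = 0
  br' : D.br w u = 0
  mu : D.mu u w = 0
  mu' : D.mu w u = 0

lemma Orthogonal.symm {u w : A} (h : D.Orthogonal u w) : D.Orthogonal w u :=
  ⟨h.br', h.br, h.mu', h.mu⟩

lemma Orthogonal.add_left {u v w : A} (h : D.Orthogonal u w) (h' : D.Orthogonal v w) :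
    D.Orthogonal (u + v) w := by
  constructor <;> simp [h.br, h.br', h.mu, h.mu', h'.br, h'.br', h'.mu, h'.mu']

lemma Orthogonal.add_right {u v w : A} (h : D.Orthogonal w u) (h' : D.Orthogonal w v) :
    D.Orthogonal w (u + v) := (h.symm.add_left h'.symm).symm

variable (D) in
/-- The elements orthogonal to `w`. -/
def annihilator (w : A) : Submodule K A where
  carrier := {u | D.Orthogonal u w}
  add_mem' := Orthogonal.add_left
  zero_mem' := by constructor <;> simp
  smul_mem' c u h := by constructor <;> simp [h.br, h.br', h.mu, h.mu']

/-- Super-skew-symmetry swaps a vanishing bracket. -/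
lemma br_eq_zero_swap {i j : ZMod 2} {x y : A} (hx : x ∈ D.grade i) (hy : y ∈ D.grade j)
    (h : D.br (D.psi y) (D.phi x) = 0) : D.br (D.psi x) (D.phi y) = 0 := by
  rw [D.skew i j x hx y hy, h, smul_zero]

lemma br_br_eq_zero {U W : Submodule K A} (hU : D.IsStable U) (hW : D.IsStable W)
    (h : ∀ u ∈ U, ∀ w ∈ W, D.Orthogonal u w) {i j k : ZMod 2} {x y z : A}
    (hx : x ∈ U) (hy : y ∈ U) (hz : z ∈ W)
    (hxi : x ∈ D.grade i) (hyj : y ∈ D.grade j) (hzk : z ∈ D.grade k) :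
    D.br z (D.br x y) = 0 := by
  obtain ⟨x, rfl⟩ := D.psi.surjective x
  obtain ⟨y, rfl⟩ := D.phi.surjective y
  obtain ⟨z, rfl⟩ := D.psi.surjective z
  obtain ⟨z, rfl⟩ := D.psi.surjective z
  simp only [hU.psi_mem_iff, hU.phi_mem_iff, hW.psi_mem_iff] at hx hy hz
  have key := D.jacobi i j k x (mem_grade_of_psi_mem hxi) y (mem_grade_of_phi_mem hyj) z
    (mem_grade_of_psi_mem (mem_grade_of_psi_mem hzk))
  rw [(h _ (hU.psi_mem_iff.2 hy) _ (hW.phi_mem_iff.2 hz)).br,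
    (h _ (hU.phi_mem_iff.2 hx) _ (hW.psi_mem_iff.2 hz)).br'] at key
  simp only [map_zero, smul_zero, zero_add] at key
  exact (smul_eq_zero.1 key).resolve_left (pow_ne_zero _ (neg_ne_zero.2 one_ne_zero))

lemma orthogonal_br {U W : Submodule K A} (hU : D.IsStable U) (hW : D.IsStable W)
    (h : ∀ u ∈ U, ∀ w ∈ W, D.Orthogonal u w) {i j k : ZMod 2} {x y z : A}
    (hx : x ∈ U) (hy : y ∈ U) (hz : z ∈ W)
    (hxi : x ∈ D.grade i) (hyj : y ∈ D.grade j) (hzk : z ∈ D.grade k) :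
    D.Orthogonal (D.br x y) z where
  br := by
    obtain ⟨x, rfl⟩ := D.psi.surjective x
    obtain ⟨y, rfl⟩ := D.psi.surjective y
    obtain ⟨z, rfl⟩ := D.phi.surjective z
    simp only [hU.psi_mem_iff, hW.phi_mem_iff] at hx hy hz
    have hxi := mem_grade_of_psi_mem hxi
    have hyj := mem_grade_of_psi_mem hyj
    have hzk := mem_grade_of_phi_mem hzk
    rw [← D.psi_br]
    refine br_eq_zero_swap (D.br_grade i j _ hxi _ hyj) hzk ?_
    rw [D.phi_br]
    exact br_br_eq_zero hU hW h (hU.phi_mem_iff.2 hx) (hU.phi_mem_iff.2 hy) (hW.psi_mem_iff.2 hz)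
      (phi_mem_grade hxi) (phi_mem_grade hyj) (psi_mem_grade hzk)
  br' := br_br_eq_zero hU hW h hx hy hz hxi hyj hzk
  mu := by
    obtain ⟨y, rfl⟩ := D.psi.surjective y
    obtain ⟨z, rfl⟩ := D.phi.surjective z
    simp only [hU.psi_mem_iff, hW.phi_mem_iff] at hx hy hz
    have key := D.leibniz k j x z (mem_grade_of_phi_mem hzk) y (mem_grade_of_psi_mem hyj)
    rw [(h _ hx _ hz).mu, (h _ (hU.phi_mem_iff.2 hy) _ hz).br'] at key
    simp only [map_zero, LinearMap.zero_apply, zero_add] at key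
    exact (smul_eq_zero.1 key.symm).resolve_left (pow_ne_zero _ (neg_ne_zero.2 one_ne_zero))
  mu' := by
    obtain ⟨y, rfl⟩ := D.phi.surjective y
    obtain ⟨z, rfl⟩ := D.phi.surjective z
    simp only [hU.phi_mem_iff, hW.phi_mem_iff] at hx hy hz
    have key := D.leibniz i j z x hxi y (mem_grade_of_phi_mem hyj)
    rw [(h _ hx _ hz).mu', (h _ (hU.psi_mem_iff.2 hy) _ hz).br'] at key
    simpa using key.symm

lemma orthogonal_mu {U W : Submodule K A} (hU : D.IsStable U) (hW : D.IsStable W)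
    (h : ∀ u ∈ U, ∀ w ∈ W, D.Orthogonal u w) {i j k : ZMod 2} {x y z : A}
    (hx : x ∈ U) (hy : y ∈ U) (hz : z ∈ W)
    (hxi : x ∈ D.grade i) (hyj : y ∈ D.grade j) (hzk : z ∈ D.grade k) :
    D.Orthogonal (D.mu x y) z := by
  have hbr : ∀ {x y z : A}, x ∈ U → y ∈ U → z ∈ W → y ∈ D.grade j → z ∈ D.grade k →
      D.br (D.mu x y) z = 0 := by
    intro x y z hx hy hz hyj hzk
    obtain ⟨z, rfl⟩ := D.psi.surjective z
    obtain ⟨z, rfl⟩ := D.phi.surjective z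
    rw [← D.phi_psi_comm] at hz hzk ⊢
    simp only [hW.psi_mem_iff, hW.phi_mem_iff] at hz
    rw [D.leibniz j k x y hyj z (mem_grade_of_psi_mem (mem_grade_of_phi_mem hzk)),
      (h _ hy _ (hW.phi_mem_iff.2 hz)).br, (h _ hx _ (hW.psi_mem_iff.2 hz)).br]
    simp
  refine ⟨hbr hx hy hz hyj hzk, ?_, ?_, ?_⟩
  · obtain ⟨x, rfl⟩ := D.phi.surjective x
    obtain ⟨y, rfl⟩ := D.phi.surjective y
    obtain ⟨z, rfl⟩ := D.psi.surjective z
    simp only [hU.phi_mem_iff, hW.psi_mem_iff] at hx hy hz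
    have hxi := mem_grade_of_phi_mem hxi
    have hyj := mem_grade_of_phi_mem hyj
    have hzk := mem_grade_of_psi_mem hzk
    rw [← D.phi_mu]
    refine br_eq_zero_swap hzk (D.mu_grade i j _ hxi _ hyj) ?_
    rw [D.psi_mu]
    exact hbr (hU.psi_mem_iff.2 hx) (hU.psi_mem_iff.2 hy) (hW.phi_mem_iff.2 hz)
      (psi_mem_grade hyj) (phi_mem_grade hzk)
  · obtain ⟨z, rfl⟩ := D.psi.surjective z
    rw [← D.assoc, (h _ hy _ (hW.psi_mem_iff.1 hz)).mu, map_zero]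
  · obtain ⟨z, rfl⟩ := D.phi.surjective z
    rw [D.assoc, (h _ hx _ (hW.phi_mem_iff.1 hz)).mu', map_zero, LinearMap.zero_apply]

lemma orthogonal_productSpan {U W : Submodule K A} (hU : D.IsStable U) (hW : D.IsStable W)
    (h : ∀ u ∈ U, ∀ w ∈ W, D.Orthogonal u w) :
    ∀ u ∈ D.productSpan U, ∀ w ∈ W, D.Orthogonal u w := by
  suffices H : ∀ k, ∀ z ∈ W, z ∈ D.grade k → D.productSpan U ≤ D.annihilator z from fun u hu =>
    homogeneous_induction hW.graded (fun k z hz hzk => H k z hz hzk hu)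
      fun _ _ => Orthogonal.add_right
  intro k z hz hzk
  have reduce : ∀ f : A →ₗ[K] A →ₗ[K] A, (∀ i j : ZMod 2, ∀ x ∈ U, ∀ y ∈ U, x ∈ D.grade i →
      y ∈ D.grade j → D.Orthogonal (f x y) z) → Submodule.map₂ f U U ≤ D.annihilator z := by
    refine fun f hf => Submodule.map₂_le.2 fun x hx y hy => ?_
    refine homogeneous_induction hU.graded (p := fun x => f x y ∈ _) (fun i x hx hxi => ?_)
      (fun u v hu hv => by rw [map_add, LinearMap.add_apply]; exact add_mem hu hv) x hx
    exact homogeneous_induction hU.graded (p := fun y => f x y ∈ _)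
      (fun j y hy hyj => hf i j x hx y hy hxi hyj)
      (fun u v hu hv => by rw [map_add]; exact add_mem hu hv) y hy
  exact sup_le
    (reduce _ fun i j x hx y hy hxi hyj => orthogonal_br hU hW h hx hy hz hxi hyj hzk)
    (reduce _ fun i j x hx y hy hxi hyj => orthogonal_mu hU hW h hx hy hz hxi hyj hzk)

lemma orthogonal_sup {U U' W : Submodule K A} (h : ∀ u ∈ U, ∀ w ∈ W, D.Orthogonal u w)
    (h' : ∀ u ∈ U', ∀ w ∈ W, D.Orthogonal u w) : ∀ u ∈ U ⊔ U', ∀ w ∈ W, D.Orthogonal u w := by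
  intro u hu w hw
  have : U ⊔ U' ≤ D.annihilator w := sup_le (fun u hu => h u hu w hw) fun u hu => h' u hu w hw
  exact this hu

/-- Orthogonality of stable subspaces passes to the subspaces enlarged by their products. -/
lemma orthogonal_sup_productSpan {U W : Submodule K A} (hU : D.IsStable U) (hW : D.IsStable W)
    (h : ∀ u ∈ U, ∀ w ∈ W, D.Orthogonal u w) :
    ∀ u ∈ U ⊔ D.productSpan U, ∀ w ∈ W ⊔ D.productSpan W, D.Orthogonal u w := by
  have h₁ := orthogonal_sup h (orthogonal_productSpan hU hW h)
  have h₂ : ∀ w ∈ W, ∀ u ∈ U ⊔ D.productSpan U, D.Orthogonal w u :=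
    fun w hw u hu => (h₁ u hu w hw).symm
  exact fun u hu w hw => (orthogonal_sup h₂
    (orthogonal_productSpan hW (hU.sup hU.productSpan) h₂) w hw u hu).symm

end Orthogonality

section Connection

variable [Field K] [AddCommGroup A] [Module K A] {D : BHPS K A}

lemma neg_mem_pm {γ : Module.Dual K ↥D.H0} {S : Set (Module.Dual K ↥D.H0)} (hγ : γ ∈ D.pm S) :
    -γ ∈ D.pm S := by
  rcases hγ with hγ | ⟨δ, hδ, rfl⟩
  · exact Or.inr ⟨γ, hγ, rfl⟩
  · exact Or.inl (by rwa [neg_neg])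

lemma twist_mem_pm {γ : Module.Dual K ↥D.H0} (hγ : γ ∈ D.pm D.roots) (a b : ℤ) :
    D.twist a b γ ∈ D.pm D.roots := by
  rcases hγ with hγ | ⟨δ, hδ, rfl⟩
  · exact Or.inl (twist_mem_roots hγ a b)
  · exact neg_mem_pm (Or.inl (twist_mem_roots hδ a b))

lemma units_smul_mem_pm {γ : Module.Dual K ↥D.H0} (hγ : γ ∈ D.pm D.roots) (ε : ℤˣ) :
    ε • γ ∈ D.pm D.roots := by
  rcases Int.units_eq_one_or ε with rfl | rfl
  · rwa [one_smul]
  · rw [Units.neg_smul, one_smul]; exact neg_mem_pm hγ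

lemma chainSum_zero (a : ℕ → Module.Dual K ↥D.H0) : D.chainSum a 0 = a 1 := by
  simp [chainSum]

lemma chainSum_succ (a : ℕ → Module.Dual K ↥D.H0) (i : ℕ) :
    D.chainSum a (i + 1)
      = D.twist (-1) 0 (D.chainSum a i) + D.twist 0 (-1) (a (i + 2)) := by
  unfold chainSum
  rw [Finset.sum_Icc_succ_top (by omega), twist_add, twist_sum, twist_twist, ← add_assoc]
  congr 2
  · congr 1; push_cast; ring
  · refine Finset.sum_congr rfl fun t _ => ?_
    rw [twist_twist]
    congr 1; push_cast; ring
  · push_cast; ring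

lemma chainSum_congr {a b : ℕ → Module.Dual K ↥D.H0} {i : ℕ}
    (h : ∀ t, 1 ≤ t → t ≤ i + 1 → a t = b t) : D.chainSum a i = D.chainSum b i := by
  unfold chainSum
  rw [h 1 le_rfl (by omega)]
  congr 1
  refine Finset.sum_congr rfl fun t ht => ?_
  rw [Finset.mem_Icc] at ht
  rw [h t (by omega) ht.2]

variable (D) in
/-- The functionals that occur as partial sums of a chain of roots starting at `α`. -/
inductive ChainReach (α : Module.Dual K ↥D.H0) : Module.Dual K ↥D.H0 → Prop
  | base (n r : ℕ) : ChainReach α (D.twist (-(n : ℤ)) (-(r : ℤ)) α)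
  | step {c b : Module.Dual K ↥D.H0} : ChainReach α c → b ∈ D.pm D.roots →
      D.twist (-1) 0 c + D.twist 0 (-1) b ∈ D.pm D.roots →
      ChainReach α (D.twist (-1) 0 c + D.twist 0 (-1) b)

lemma ChainReach.twist {α c : Module.Dual K ↥D.H0} (h : D.ChainReach α c) (n r : ℕ) :
    D.ChainReach α (D.twist (-(n : ℤ)) (-(r : ℤ)) c) := by
  induction h with
  | base m s =>
    have := ChainReach.base (D := D) (α := α) (n + m) (r + s)
    rw [twist_twist]
    convert this using 2 <;> push_cast <;> ring
  | @step c b _ hb hsum ih =>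
    have e : D.twist (-(n : ℤ)) (-(r : ℤ)) (D.twist (-1) 0 c + D.twist 0 (-1) b)
        = D.twist (-1) 0 (D.twist (-(n : ℤ)) (-(r : ℤ)) c)
          + D.twist 0 (-1) (D.twist (-(n : ℤ)) (-(r : ℤ)) b) := by
      simp only [twist_add, twist_twist]
      congr 2 <;> ring
    rw [e]
    exact ih.step (twist_mem_pm hb _ _) (e ▸ twist_mem_pm hsum _ _)

lemma ChainReach.mem_pm {α c : Module.Dual K ↥D.H0} (hα : α ∈ D.roots) (h : D.ChainReach α c) :
    c ∈ D.pm D.roots := by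
  cases h with
  | base n r => exact twist_mem_pm (Or.inl hα) _ _
  | step _ _ h => exact h

lemma ChainReach.exists_chain {α c : Module.Dual K ↥D.H0} (hα : α ∈ D.roots)
    (h : D.ChainReach α c) :
    ∃ (l : ℕ) (a : ℕ → Module.Dual K ↥D.H0),
      (∀ t, 1 ≤ t → t ≤ l + 1 → a t ∈ D.pm D.roots) ∧
      (∃ n r : ℕ, a 1 = D.twist (-(n : ℤ)) (-(r : ℤ)) α) ∧
      (∀ i, 1 ≤ i → i ≤ l → D.chainSum a i ∈ D.pm D.roots) ∧ D.chainSum a l = c := by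
  induction h with
  | base n r =>
    exact ⟨0, fun _ => D.twist (-(n : ℤ)) (-(r : ℤ)) α,
      fun _ _ _ => twist_mem_pm (Or.inl hα) _ _, ⟨n, r, rfl⟩, fun i h1 h2 => by omega,
      chainSum_zero _⟩
  | @step c b _ hb hsum ih =>
    obtain ⟨l, a, ha, ⟨n, r, h1⟩, hs, rfl⟩ := ih
    have hlow : ∀ t, t ≤ l + 1 → Function.update a (l + 2) b t = a t := fun t ht =>
      Function.update_of_ne (by omega) _ _
    have hsums : ∀ i, i ≤ l → D.chainSum (Function.update a (l + 2) b) i = D.chainSum a i :=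
      fun i hi => chainSum_congr fun t _ ht => hlow t (by omega)
    have hlast : D.chainSum (Function.update a (l + 2) b) (l + 1)
        = D.twist (-1) 0 (D.chainSum a l) + D.twist 0 (-1) b := by
      rw [chainSum_succ, hsums l le_rfl, Function.update_self]
    refine ⟨l + 1, Function.update a (l + 2) b, fun t ht1 ht2 => ?_,
      ⟨n, r, by rw [hlow 1 (by omega), h1]⟩, fun i hi1 hi2 => ?_, hlast⟩
    · rcases Nat.lt_or_ge (l + 1) t with h | h
      · obtain rfl : t = l + 2 := by omega
        rwa [Function.update_self]
      · rw [hlow t h]; exact ha t ht1 h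
    · rcases Nat.lt_or_ge l i with h | h
      · obtain rfl : i = l + 1 := by omega
        rwa [hlast]
      · rw [hsums i h]; exact hs i hi1 h

lemma exists_units_smul_iff {c β : Module.Dual K ↥D.H0} :
    (∃ ε : ℤˣ, c = ε • β) ↔ c = β ∨ c = -β := by
  constructor
  · rintro ⟨ε, rfl⟩
    rcases Int.units_eq_one_or ε with rfl | rfl <;> simp
  · rintro (rfl | rfl)
    · exact ⟨1, by simp⟩
    · exact ⟨-1, by simp⟩

lemma connected_iff {α β : Module.Dual K ↥D.H0} (hα : α ∈ D.roots) (hβ : β ∈ D.roots) :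
    D.Connected α β ↔
      ∃ (ε : ℤˣ) (m s : ℕ), D.ChainReach α (ε • D.twist (-(m : ℤ)) (-(s : ℤ)) β) := by
  constructor
  · rintro (⟨z₁, z₂, ε, hε, rfl⟩ | ⟨k, a, hk, ha, ⟨n, r, h1⟩, hs, m, s, hend⟩)
    · obtain ⟨η, hη⟩ : ∃ η : ℤˣ, ε • D.twist z₁ z₂ α = η • D.twist z₁ z₂ α :=
        (exists_units_smul_iff (β := D.twist z₁ z₂ α)).2 (by
          rcases hε with rfl | rfl
          · exact Or.inl (one_smul _ _)
          · exact Or.inr (LinearMap.ext fun _ => neg_one_mul _))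
      refine ⟨η, z₁.toNat, z₂.toNat, ?_⟩
      rw [hη, twist_units_smul, smul_smul, Int.units_mul_self, one_smul, twist_twist]
      convert ChainReach.base (D := D) (α := α) (-z₁).toNat (-z₂).toNat using 2 <;> omega
    · obtain ⟨ε, hε⟩ := exists_units_smul_iff.2 hend
      refine ⟨ε, m, s, ?_⟩
      rw [← hε]
      have hsum : ∀ i, 1 ≤ i → i ≤ k - 1 → D.chainSum a i ∈ D.pm D.roots := fun i h1 h2 => by
        rcases Nat.lt_or_ge (k - 2) i with h | h
        · obtain rfl : i = k - 1 := by omega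
          rw [hε]
          exact units_smul_mem_pm (twist_mem_pm (Or.inl hβ) _ _) _
        · exact hs i h1 h
      have reach : ∀ i, i ≤ k - 1 → D.ChainReach α (D.chainSum a i) := by
        intro i
        induction i with
        | zero => intro _; rw [chainSum_zero, h1]; exact ChainReach.base n r
        | succ i ih =>
          intro hi
          have := hsum (i + 1) (by omega) hi
          rw [chainSum_succ] at this ⊢
          exact (ih (by omega)).step (ha _ (by omega) (by omega)) this
      exact reach _ le_rfl
  · rintro ⟨ε, m, s, h⟩
    obtain ⟨l, a, ha, ⟨n, r, h1⟩, hs, hend⟩ := h.exists_chain hα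
    rcases Nat.eq_zero_or_pos l with rfl | hl
    · rw [chainSum_zero, h1] at hend
      have hβα : β = ε • D.twist (m - n : ℤ) (s - r : ℤ) α := by
        have := congrArg (fun γ => ε • D.twist m s γ) hend
        simpa [smul_smul, sub_eq_add_neg] using this.symm
      rcases Int.units_eq_one_or ε with rfl | rfl
      · exact Or.inl ⟨m - n, s - r, 1, Or.inl rfl, by rwa [one_smul] at hβα ⊢⟩
      · exact Or.inl ⟨m - n, s - r, -1, Or.inr rfl, by
          rwa [Units.neg_smul, one_smul, ← neg_one_smul K] at hβα⟩
    · refine Or.inr ⟨l + 1, a, by omega, fun t h1 h2 => ha t h1 h2, ⟨n, r, h1⟩,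
        fun i h1 h2 => hs i h1 (by omega), m, s, ?_⟩
      exact exists_units_smul_iff.1 ⟨ε, hend⟩

variable (D) in
/-- Up to sign and twist, `x` and `y` differ by zero or by an element of `±Λ`. -/
def Adjacent (x y : Module.Dual K ↥D.H0) : Prop :=
  ∃ (ε : ℤˣ) (z₁ z₂ : ℤ), y - ε • D.twist z₁ z₂ x = 0 ∨ y - ε • D.twist z₁ z₂ x ∈ D.pm D.roots

lemma Adjacent.symm {x y : Module.Dual K ↥D.H0} (h : D.Adjacent x y) : D.Adjacent y x := by
  obtain ⟨ε, z₁, z₂, h⟩ := h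
  refine ⟨ε, -z₁, -z₂, ?_⟩
  have e : x - ε • D.twist (-z₁) (-z₂) y
      = -(ε • D.twist (-z₁) (-z₂) (y - ε • D.twist z₁ z₂ x)) := by
    simp [smul_sub, smul_smul]
  rw [e]
  refine h.imp (fun h => by simp [h]) fun h => neg_mem_pm (units_smul_mem_pm (twist_mem_pm h _ _) _)

variable (D) in
/-- One step between elements of `±Λ`. -/
def PmStep (x y : Module.Dual K ↥D.H0) : Prop :=
  x ∈ D.pm D.roots ∧ y ∈ D.pm D.roots ∧ D.Adjacent x y

instance : Std.Symm D.PmStep where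
  symm _ _ h := ⟨h.2.1, h.1, h.2.2.symm⟩

lemma pmStep_twist {x : Module.Dual K ↥D.H0} (hx : x ∈ D.pm D.roots) (ε : ℤˣ) (z₁ z₂ : ℤ) :
    D.PmStep x (ε • D.twist z₁ z₂ x) :=
  ⟨hx, units_smul_mem_pm (twist_mem_pm hx _ _) _, ε, z₁, z₂, Or.inl (sub_self _)⟩

lemma ChainReach.reflTransGen {α c : Module.Dual K ↥D.H0} (hα : α ∈ D.roots)
    (h : D.ChainReach α c) : Relation.ReflTransGen D.PmStep α c := by
  induction h with
  | base n r =>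
    have := pmStep_twist (D := D) (Or.inl hα) 1 (-(n : ℤ)) (-(r : ℤ))
    rw [one_smul] at this
    exact .single this
  | step hc hb hsum ih =>
    refine ih.tail ⟨hc.mem_pm hα, hsum, 1, -1, 0, Or.inr ?_⟩
    rw [one_smul, add_sub_cancel_left]
    exact twist_mem_pm hb _ _

lemma exists_chainReach_of_reflTransGen {α β : Module.Dual K ↥D.H0}
    (h : Relation.ReflTransGen D.PmStep α β) :
    ∃ (ε : ℤˣ) (m s : ℕ), D.ChainReach α (ε • D.twist (-(m : ℤ)) (-(s : ℤ)) β) := by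
  induction h with
  | refl =>
    refine ⟨1, 0, 0, ?_⟩
    rw [one_smul]; exact ChainReach.base 0 0
  | @tail y z _ hyz ih =>
    obtain ⟨ε, m, s, hc⟩ := ih
    obtain ⟨-, hz, η, z₁, z₂, hb⟩ := hyz
    have hc' := hc.twist (-z₁).toNat (-z₂).toNat
    have hy : y = η • D.twist (-z₁) (-z₂) (z - (z - η • D.twist z₁ z₂ y)) := by
      simp [smul_smul]
    generalize z - η • D.twist z₁ z₂ y = b at hy hb
    subst hy
    rcases hb with rfl | hb
    · refine ⟨ε * η, (z₁ + m + (-z₁).toNat).toNat, (z₂ + s + (-z₂).toNat).toNat, ?_⟩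
      convert hc' using 1
      simp only [sub_zero, twist_units_smul, twist_twist, smul_smul]
      congr 3 <;> omega
    · have e : (ε * η) • D.twist (-((z₁ + m + (-z₁).toNat + 1).toNat : ℤ))
          (-((z₂ + s + (-z₂).toNat).toNat : ℤ)) z
          = D.twist (-1) 0 (D.twist (-((-z₁).toNat : ℤ)) (-((-z₂).toNat : ℤ))
              (ε • D.twist (-(m : ℤ)) (-(s : ℤ)) (η • D.twist (-z₁) (-z₂) (z - b))))
            + D.twist 0 (-1) ((ε * η) • D.twist (-(z₁ + m + (-z₁).toNat + 1))
              (1 - (z₂ + s + (-z₂).toNat)) b) := by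
        simp only [twist_units_smul, twist_twist, twist_sub, smul_smul, ← smul_add]
        have key : ∀ p p' p'' q q' q'' : ℤ, p = p' → p = p'' → q = q' → q = q'' →
            D.twist p q z = D.twist p' q' z - D.twist p' q' b + D.twist p'' q'' b := by
          rintro p _ _ q _ _ rfl rfl rfl rfl
          abel
        congr 1
        apply key <;> omega
      refine ⟨ε * η, _, _, e ▸ hc'.step (units_smul_mem_pm (twist_mem_pm hb _ _) _) ?_⟩
      rw [← e]
      exact units_smul_mem_pm (twist_mem_pm hz _ _) _

lemma connected_iff_reflTransGen {α β : Module.Dual K ↥D.H0} (hα : α ∈ D.roots)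
    (hβ : β ∈ D.roots) : D.Connected α β ↔ Relation.ReflTransGen D.PmStep α β := by
  rw [connected_iff hα hβ]
  refine ⟨fun ⟨ε, m, s, h⟩ => ?_, exists_chainReach_of_reflTransGen⟩
  exact (h.reflTransGen hα).tail (symm (pmStep_twist (Or.inl hβ) _ _ _))

lemma connected_equivalence : Equivalence fun α β : ↥D.roots => D.Connected α.1 β.1 := by
  simp only [connected_iff_reflTransGen (Subtype.prop _) (Subtype.prop _)]
  refine ⟨fun _ => .refl, symm, fun h h' => h.trans h'⟩

lemma Connected.classSet_eq {α β : Module.Dual K ↥D.H0} (hα : α ∈ D.roots) (hβ : β ∈ D.roots)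
    (h : D.Connected α β) : D.classSet α = D.classSet β := by
  have eqv := connected_equivalence (D := D)
  ext γ
  refine and_congr_right fun hγ => ⟨fun h' => ?_, fun h' => ?_⟩
  · exact eqv.trans (x := ⟨β, hβ⟩) (y := ⟨α, hα⟩) (z := ⟨γ, hγ⟩)
      (eqv.symm (x := ⟨α, hα⟩) (y := ⟨β, hβ⟩) h) h'
  · exact eqv.trans (x := ⟨α, hα⟩) (y := ⟨β, hβ⟩) (z := ⟨γ, hγ⟩) h h'

lemma mem_classSet_self {α : Module.Dual K ↥D.H0} (hα : α ∈ D.roots) : α ∈ D.classSet α :=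
  ⟨hα, connected_equivalence.refl ⟨α, hα⟩⟩

lemma classSet_eq_of_mem {α β : Module.Dual K ↥D.H0} (hα : α ∈ D.roots)
    (hβ : β ∈ D.classSet α) : D.classSet α = D.classSet β :=
  hβ.2.classSet_eq hα hβ.1

lemma mem_classSet_of_pmStep {α β γ : Module.Dual K ↥D.H0} (hα : α ∈ D.roots)
    (hβ : β ∈ D.classSet α) (hγ : γ ∈ D.roots) (h : D.PmStep β γ) : γ ∈ D.classSet α := by
  rw [classSet_eq_of_mem hα hβ]
  exact ⟨hγ, (connected_iff_reflTransGen hβ.1 hγ).2 (.single h)⟩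

lemma twist_mem_classSet {α β : Module.Dual K ↥D.H0} (hα : α ∈ D.roots)
    (hβ : β ∈ D.classSet α) (a b : ℤ) : D.twist a b β ∈ D.classSet α :=
  mem_classSet_of_pmStep hα hβ (twist_mem_roots hβ.1 a b) (by
    simpa using pmStep_twist (Or.inl hβ.1) 1 a b)

/-- Root spaces of roots in different classes are orthogonal. -/
lemma orthogonal_of_classSet_ne {γ δ : Module.Dual K ↥D.H0} (hγ : γ ∈ D.roots)
    (hδ : δ ∈ D.roots) (hne : D.classSet γ ≠ D.classSet δ) :
    ∀ u ∈ D.rootSpace γ, ∀ w ∈ D.rootSpace δ, D.Orthogonal u w := by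
  have key : ∀ {γ δ}, γ ∈ D.roots → δ ∈ D.roots → D.classSet γ ≠ D.classSet δ →
      D.rootSpace (D.twist (-1) 0 γ + D.twist 0 (-1) δ) = ⊥ := by
    intro γ δ hγ hδ hne
    by_contra hbot
    refine hne (Connected.classSet_eq hγ hδ ((connected_iff_reflTransGen hγ hδ).2 ?_))
    by_cases h0 : D.twist (-1) 0 γ + D.twist 0 (-1) δ = 0
    · have h1 := congrArg (D.twist 0 1) h0
      simp only [twist_add, twist_twist, twist_zero] at h1
      refine .single ⟨Or.inl hγ, Or.inl hδ, -1, -1, 1, Or.inl ?_⟩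
      simpa [add_comm] using h1
    · have hsum : D.twist (-1) 0 γ + D.twist 0 (-1) δ ∈ D.pm D.roots := Or.inl ⟨h0, hbot⟩
      refine .single ⟨Or.inl hγ, Or.inl hδ, -1, -1, 1, Or.inr ?_⟩
      simpa [add_comm] using twist_mem_pm hsum 0 1
  have hγδ : ∀ v ∈ D.rootSpace (D.twist (-1) 0 γ + D.twist 0 (-1) δ), v = 0 := fun v hv => by
    rwa [key hγ hδ hne, Submodule.mem_bot] at hv
  have hδγ : ∀ v ∈ D.rootSpace (D.twist (-1) 0 δ + D.twist 0 (-1) γ), v = 0 := fun v hv => by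
    rwa [key hδ hγ hne.symm, Submodule.mem_bot] at hv
  exact fun u hu w hw => ⟨hγδ _ (br_mem_rootSpace hu hw), hδγ _ (br_mem_rootSpace hw hu),
    hγδ _ (mu_mem_rootSpace hu hw), hδγ _ (mu_mem_rootSpace hw hu)⟩

lemma rootSpace_le_VS {α β : Module.Dual K ↥D.H0} (hβ : β ∈ D.classSet α) :
    D.rootSpace β ≤ D.VS α :=
  le_iSup₂_of_le β hβ le_rfl

lemma isStable_VS {α : Module.Dual K ↥D.H0} (hα : α ∈ D.roots) : D.IsStable (D.VS α) where
  graded := iSup₂_le fun β hβ => (rootSpace_graded β).trans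
    (sup_le_sup (inf_le_inf_right _ (rootSpace_le_VS hβ)) (inf_le_inf_right _ (rootSpace_le_VS hβ)))
  map_phi := by
    refine le_antisymm ?_ ?_
    · simp only [VS, Submodule.map_iSup, map_phi_rootSpace]
      exact iSup₂_le fun β hβ => rootSpace_le_VS (twist_mem_classSet hα hβ _ _)
    · refine iSup₂_le fun β hβ => ?_
      have : D.rootSpace β = (D.rootSpace (D.twist 1 0 β)).map (D.phi : A →ₗ[K] A) := by
        rw [map_phi_rootSpace, twist_twist]; rfl
      rw [this]
      exact Submodule.map_mono (rootSpace_le_VS (twist_mem_classSet hα hβ _ _))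
  map_psi := by
    refine le_antisymm ?_ ?_
    · simp only [VS, Submodule.map_iSup, map_psi_rootSpace]
      exact iSup₂_le fun β hβ => rootSpace_le_VS (twist_mem_classSet hα hβ _ _)
    · refine iSup₂_le fun β hβ => ?_
      have : D.rootSpace β = (D.rootSpace (D.twist 0 1 β)).map (D.psi : A →ₗ[K] A) := by
        rw [map_psi_rootSpace, twist_twist]; rfl
      rw [this]
      exact Submodule.map_mono (rootSpace_le_VS (twist_mem_classSet hα hβ _ _))

lemma rootSpace_neg_le_VS {α β : Module.Dual K ↥D.H0} (hα : α ∈ D.roots)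
    (hβ : β ∈ D.classSet α) : D.rootSpace (-D.twist (-1) 0 β) ≤ D.VS α := by
  by_cases hbot : D.rootSpace (-D.twist (-1) 0 β) = ⊥
  · simp [hbot]
  have hroot : -D.twist (-1) 0 β ∈ D.roots :=
    ⟨fun h => hβ.1.1 (D.twist_eq_zero_iff.1 (neg_eq_zero.1 h)), hbot⟩
  refine rootSpace_le_VS (mem_classSet_of_pmStep hα hβ hroot ?_)
  simpa using pmStep_twist (Or.inl hβ.1) (-1) (-1) 0

lemma IH_le_productSpan {α : Module.Dual K ↥D.H0} (hα : α ∈ D.roots) :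
    D.IH α ≤ D.productSpan (D.VS α) := by
  refine iSup₂_le fun β hβ => ?_
  have h₁ : D.rootSpace (D.twist 0 (-1) β) ≤ D.VS α :=
    rootSpace_le_VS (twist_mem_classSet hα hβ _ _)
  have h₂ := rootSpace_neg_le_VS hα hβ
  exact sup_le_sup (Submodule.map₂_le_map₂ h₁ h₂) (Submodule.map₂_le_map₂ h₁ h₂)

lemma orthogonal_VS {α β : Module.Dual K ↥D.H0} (hα : α ∈ D.roots) (hβ : β ∈ D.roots)
    (hne : D.classSet α ≠ D.classSet β) : ∀ u ∈ D.VS α, ∀ w ∈ D.VS β, D.Orthogonal u w := by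
  have h₁ : ∀ δ ∈ D.classSet β, ∀ w ∈ D.rootSpace δ, D.VS α ≤ D.annihilator w :=
    fun δ hδ w hw => iSup₂_le fun γ hγ u hu => orthogonal_of_classSet_ne hγ.1 hδ.1
      (by rwa [← classSet_eq_of_mem hα hγ, ← classSet_eq_of_mem hβ hδ]) u hu w hw
  intro u hu w hw
  have h₂ : D.VS β ≤ D.annihilator u := iSup₂_le fun δ hδ w hw => (h₁ δ hδ w hw hu).symm
  exact (h₂ hw).symm

lemma orthogonal_Iclass {α β : Module.Dual K ↥D.H0} (hα : α ∈ D.roots) (hβ : β ∈ D.roots)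
    (hne : D.classSet α ≠ D.classSet β) :
    ∀ u ∈ D.Iclass α, ∀ w ∈ D.Iclass β, D.Orthogonal u w := by
  have hle : ∀ {α}, α ∈ D.roots → D.Iclass α ≤ D.VS α ⊔ D.productSpan (D.VS α) := fun hα =>
    sup_le ((IH_le_productSpan hα).trans le_sup_right) le_sup_left
  exact fun u hu w hw => orthogonal_sup_productSpan (isStable_VS hα) (isStable_VS hβ)
    (orthogonal_VS hα hβ hne) u (hle hα hu) w (hle hβ hw)

lemma Iclass_congr {α β : Module.Dual K ↥D.H0} (h : D.classSet α = D.classSet β) :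
    D.Iclass α = D.Iclass β := by
  simp only [Iclass, IH, VS, h]

lemma iSup_Iclass_eq_top (hsplit : D.IsSplit) (hH : D.H = D.HSum) :
    ⨆ α ∈ D.roots, D.Iclass α = ⊤ := by
  let _ := Classical.decEq (Option ↥D.roots)
  have htop := DirectSum.IsInternal.submodule_iSup_eq_top hsplit
  rw [eq_top_iff, ← htop]
  refine iSup_le fun o => ?_
  cases o with
  | none =>
    change D.H ≤ _
    rw [hH]
    exact iSup₂_le fun α hα => le_iSup₂_of_le α hα
      (le_sup_of_le_left (le_iSup₂_of_le α (mem_classSet_self hα) le_rfl))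
  | some α =>
    exact le_iSup₂_of_le α.1 α.2
      (le_sup_of_le_right (rootSpace_le_VS (mem_classSet_self α.2)))

end Connection

/-- if `Z(A) = 0` and `H = Σ_{α∈Λ}(...)` then `A = ⊕_{[α]∈Λ/∼} I_{[α]}`,
with `[I_{[α]}, I_{[β]}] + I_{[α]}·I_{[β]} = 0` for `[α] ≠ [β]`. -/
theorem directSum_decomposition {K A : Type*} [Field K] [AddCommGroup A] [Module K A] (D : BHPS K A)
    (hsplit : D.IsSplit)
    (hZ : D.center = ⊥) (hH : D.H = D.HSum) :
    (⨆ α ∈ D.roots, D.Iclass α) = ⊤ ∧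
    (∀ α ∈ D.roots,
      D.Iclass α ⊓ (⨆ β ∈ D.roots, ⨆ _ : D.classSet α ≠ D.classSet β, D.Iclass β) = ⊥) ∧
    (∀ α ∈ D.roots, ∀ β ∈ D.roots, D.classSet α ≠ D.classSet β →
      Submodule.map₂ D.br (D.Iclass α) (D.Iclass β)
        ⊔ Submodule.map₂ D.mu (D.Iclass α) (D.Iclass β) = ⊥) := by
  have htop := iSup_Iclass_eq_top hsplit hH
  refine ⟨htop, fun α hα => ?_, fun α hα β hβ hne => ?_⟩
  · rw [← le_bot_iff, ← hZ]
    rintro x ⟨hxα, hxβ⟩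
    have hann : ⊤ ≤ D.annihilator x := by
      rw [← htop]
      refine iSup₂_le fun β hβ => ?_
      by_cases h : D.classSet α = D.classSet β
      · intro u hu
        rw [← Iclass_congr h] at hu
        have hle : (⨆ β ∈ D.roots, ⨆ _ : D.classSet α ≠ D.classSet β, D.Iclass β)
            ≤ D.annihilator u := iSup₂_le fun γ hγ => iSup_le fun hne w hw =>
          (orthogonal_Iclass hα hγ hne u hu w hw).symm
        exact (hle hxβ).symm
      · exact fun u hu => (orthogonal_Iclass hα hβ h x hxα u hu).symm
    intro w
    have hw : D.Orthogonal w x := hann Submodule.mem_top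
    exact ⟨hw.br', hw.mu', hw.mu⟩
  · have h := orthogonal_Iclass hα hβ hne
    rw [← le_bot_iff]
    exact sup_le (Submodule.map₂_le.2 fun u hu w hw => (h u hu w hw).br)
      (Submodule.map₂_le.2 fun u hu w hw => (h u hu w hw).mu)

end BHPS
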